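/- arXiv:1406.0177 — 7 statements merged into one kernel-verified Lean document; each statement's English description precedes it below -/
import Mathlib

section
/- Suppose φ : [0,∞) → [0,∞) satisfies φ(0) = 0, φ is continuous, and the derivative φ′ is completely monotone on (0,∞) (i.e. φ′ is infinitely differentiable on (0,∞) and (−1)^k (φ′)^{(k)}(x) ≥ 0 for all k ≥ 0 and all x > 0). Then there exists a probability measure F on [0,∞) such that e^{−φ(x)} = ∫₀^∞ e^{−λx} dF(λ) for all x ≥ 0. -/
open MeasureTheory

/-- Taylor remainder at `0` of a chain of functions. -/
noncomputable def tayRem (G : ℕ → ℝ → ℝ) (n : ℕ) (s : ℝ) : ℝ :=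
  G 0 s - ∑ k ∈ Finset.range n, G k 0 / (k.factorial : ℝ) * s ^ k

lemma tayRem_hasDerivAt (G : ℕ → ℝ → ℝ) (hG : ∀ k s, s < 1 → HasDerivAt (G k) (G (k + 1) s) s)
    (n : ℕ) (s : ℝ) (hs : s < 1) :
    HasDerivAt (tayRem G (n + 1)) (tayRem (fun k => G (k + 1)) n s) s := by
  unfold tayRem
  refine (hG 0 s hs).sub ?_
  have h : ∀ k ∈ Finset.range (n + 1), HasDerivAt
      (fun s : ℝ => G k 0 / (k.factorial : ℝ) * s ^ k)
      (G k 0 / (k.factorial : ℝ) * (k * s ^ (k - 1))) s := by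
    intro k _
    exact (hasDerivAt_pow k s).const_mul _
  have h2 := HasDerivAt.fun_sum h
  refine h2.congr_deriv ?_
  rw [Finset.sum_range_succ']
  simp only [Nat.cast_zero, zero_mul, mul_zero, add_zero]
  refine Finset.sum_congr rfl fun k _ => ?_
  have : ((k.factorial : ℕ) : ℝ) ≠ 0 := by positivity
  rw [Nat.factorial_succ]
  push_cast
  field_simp

lemma tayRem_zero (G : ℕ → ℝ → ℝ) (n : ℕ) : tayRem G (n + 1) 0 = 0 := by
  unfold tayRem
  rw [Finset.sum_range_succ']
  simp

lemma mono_aux (f f' : ℝ → ℝ) (hf : ∀ s, s < 1 → HasDerivAt f (f' s) s)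
    (h0 : ∀ s, 0 ≤ s → s < 1 → 0 ≤ f' s) : MonotoneOn f (Set.Ico 0 1) := by
  refine monotoneOn_of_deriv_nonneg (convex_Ico 0 1)
    (fun x hx => (hf x hx.2).continuousAt.continuousWithinAt) ?_ ?_
  · intro x hx
    rw [interior_Ico] at hx
    exact (hf x hx.2).differentiableAt.differentiableWithinAt
  · intro x hx
    rw [interior_Ico] at hx
    rw [(hf x hx.2).deriv]
    exact h0 x hx.1.le hx.2

lemma tayRem_nonneg (n : ℕ) : ∀ (G : ℕ → ℝ → ℝ)
    (_ : ∀ k s, s < 1 → HasDerivAt (G k) (G (k + 1) s) s)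
    (_ : ∀ k s, s < 1 → 0 ≤ G k s) (s : ℝ), 0 ≤ s → s < 1 → 0 ≤ tayRem G n s := by
  induction n with
  | zero => intro G hG h0 s _ hs1; simpa [tayRem] using h0 0 s hs1
  | succ n ih =>
    intro G hG h0 s hs hs1
    have := mono_aux _ _ (tayRem_hasDerivAt G hG n)
      (ih (fun k => G (k + 1)) (fun k => hG (k + 1)) (fun k => h0 (k + 1)))
      (⟨le_rfl, one_pos⟩ : (0 : ℝ) ∈ Set.Ico 0 1) ⟨hs, hs1⟩ hs
    rwa [tayRem_zero] at this

lemma tayRem_le (n : ℕ) : ∀ (G : ℕ → ℝ → ℝ)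
    (_ : ∀ k s, s < 1 → HasDerivAt (G k) (G (k + 1) s) s)
    (_ : ∀ k s, s < 1 → 0 ≤ G k s) (s t : ℝ), 0 ≤ s → s < 1 → 0 ≤ t → t < 1 →
    tayRem G n (t * s) ≤ t ^ n * tayRem G n s := by
  induction n with
  | zero =>
    intro G hG h0 s t hs hs1 ht ht1
    have := mono_aux _ _ (hG 0) (fun s _ h => h0 1 s h)
      (⟨by positivity, by nlinarith⟩ : t * s ∈ Set.Ico (0:ℝ) 1) ⟨hs, hs1⟩ (by nlinarith)
    simpa [tayRem] using this
  | succ n ih =>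
    intro G hG h0 s t hs hs1 ht ht1
    have ih' := ih (fun k => G (k + 1)) (fun k => hG (k + 1)) (fun k => h0 (k + 1))
    rcases ht.eq_or_lt with rfl | htpos
    · simp [tayRem_zero]
    have hd : ∀ s, s < 1 → 0 ≤ s → HasDerivAt
        (fun s => t ^ (n + 1) * tayRem G (n + 1) s - tayRem G (n + 1) (t * s))
        (t ^ (n + 1) * tayRem (fun k => G (k + 1)) n s
          - tayRem (fun k => G (k + 1)) n (t * s) * t) s := by
      intro s hs hs0
      refine ((tayRem_hasDerivAt G hG n s hs).const_mul _).sub ?_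
      have h1 := tayRem_hasDerivAt G hG n (t * s) (by nlinarith)
      have h2 : HasDerivAt (fun s : ℝ => t * s) t s := by
        simpa using (hasDerivAt_id s).const_mul t
      exact h1.comp s h2
    have hm : MonotoneOn
        (fun s => t ^ (n + 1) * tayRem G (n + 1) s - tayRem G (n + 1) (t * s))
        (Set.Ico 0 1) := by
      refine monotoneOn_of_deriv_nonneg (convex_Ico 0 1)
        (fun x hx => (hd x hx.2 hx.1).continuousAt.continuousWithinAt) ?_ ?_
      · intro x hx
        rw [interior_Ico] at hx
        exact (hd x hx.2 hx.1.le).differentiableAt.differentiableWithinAt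
      · intro x hx
        rw [interior_Ico] at hx
        rw [(hd x hx.2 hx.1.le).deriv]
        have := ih' x t hx.1.le hx.2 ht ht1
        have := mul_le_mul_of_nonneg_right this ht
        rw [pow_succ]
        linarith
    have := hm (⟨le_rfl, one_pos⟩ : (0 : ℝ) ∈ Set.Ico 0 1) ⟨hs, hs1⟩ hs
    simp only [mul_zero, tayRem_zero] at this
    linarith

/-- Bounds for Taylor remainders of absolutely monotone functions bounded by one. -/
lemma tay_bounds (G : ℕ → ℝ → ℝ)
    (hG : ∀ k s, s < 1 → HasDerivAt (G k) (G (k + 1) s) s)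
    (h0 : ∀ k s, s < 1 → 0 ≤ G k s) (h1 : ∀ s, s < 1 → G 0 s ≤ 1) (n : ℕ) (s : ℝ)
    (hs : 0 ≤ s) (hs1 : s < 1) :
    0 ≤ tayRem G n s ∧ tayRem G n s ≤ (√s) ^ n := by
  refine ⟨tayRem_nonneg n G hG h0 s hs hs1, ?_⟩
  have hq : √s < 1 := by rw [Real.sqrt_lt' one_pos]; simpa using hs1
  have h := tayRem_le n G hG h0 (√s) (√s) (Real.sqrt_nonneg s) hq (Real.sqrt_nonneg s) hq
  rw [Real.mul_self_sqrt hs] at h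
  refine h.trans ?_
  have h2 : tayRem G n (√s) ≤ 1 := by
    refine le_trans ?_ (h1 _ hq)
    unfold tayRem
    have : 0 ≤ ∑ k ∈ Finset.range n, G k 0 / (k.factorial : ℝ) * (√s) ^ k :=
      Finset.sum_nonneg fun k _ => by
        have := h0 k 0 one_pos
        positivity
    linarith
  have : 0 ≤ (√s) ^ n := by positivity
  nlinarith

lemma tay_sum_le (G : ℕ → ℝ → ℝ)
    (hG : ∀ k s, s < 1 → HasDerivAt (G k) (G (k + 1) s) s)
    (h0 : ∀ k s, s < 1 → 0 ≤ G k s) (h1 : ∀ s, s < 1 → G 0 s ≤ 1) (n : ℕ) :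
    ∑ k ∈ Finset.range n, G k 0 / (k.factorial : ℝ) ≤ 1 := by
  have hc : Continuous fun s : ℝ => ∑ k ∈ Finset.range n, G k 0 / (k.factorial : ℝ) * s ^ k := by
    fun_prop
  have ht := (hc.tendsto 1).mono_left (nhdsWithin_le_nhds (s := Set.Iio 1))
  simp only [one_pow, mul_one] at ht
  refine le_of_tendsto ht ?_
  filter_upwards [Ioo_mem_nhdsLT (zero_lt_one' ℝ)] with s hs
  have a := tayRem_nonneg n G hG h0 s hs.1.le hs.2
  have b := h1 s hs.2
  unfold tayRem at a
  linarith

/-- `exp (-φ)` is completely monotone. -/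
lemma cm_exp (φ φ' : ℝ → ℝ)
    (hderiv : ∀ x : ℝ, 0 < x → HasDerivAt φ (φ' x) x)
    (hsmooth : ∀ k : ℕ, ContDiffOn ℝ k φ' (Set.Ioi 0))
    (hcm : ∀ (k : ℕ) (x : ℝ), 0 < x →
      0 ≤ (-1 : ℝ) ^ k * iteratedDerivWithin k φ' (Set.Ioi 0) x) :
    ∃ f : ℕ → ℝ → ℝ, (f 0 = fun x => Real.exp (-(φ x))) ∧
      (∀ k x, 0 < x → HasDerivAt (f k) (f (k + 1) x) x) ∧
      (∀ k x, 0 < x → 0 ≤ (-1 : ℝ) ^ k * f k x) := by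
  set e : ℝ → ℝ := fun x => Real.exp (-(φ x)) with he
  have hu : UniqueDiffOn ℝ (Set.Ioi (0:ℝ)) := isOpen_Ioi.uniqueDiffOn
  have hφs : ∀ k : ℕ, ContDiffOn ℝ k φ (Set.Ioi 0) := by
    intro k
    have : ContDiffOn ℝ ((k : WithTop ℕ∞) + 1) φ (Set.Ioi 0) := by
      rw [contDiffOn_succ_iff_derivWithin hu]
      refine ⟨fun x hx => (hderiv x hx).differentiableAt.differentiableWithinAt, by simp, ?_⟩
      refine (hsmooth k).congr fun x hx => ?_
      exact (hderiv x hx).hasDerivWithinAt.derivWithin (hu x hx)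
    exact this.of_le (by exact_mod_cast Nat.le_succ k)
  have hes : ∀ k : ℕ, ContDiffOn ℝ k e (Set.Ioi 0) := fun k => (hφs k).neg.exp
  have hde : Set.EqOn (derivWithin e (Set.Ioi 0)) (-(φ' * e)) (Set.Ioi 0) := by
    intro x hx
    have := ((hderiv x hx).neg.exp).hasDerivWithinAt.derivWithin (hu x hx)
    refine Eq.trans this ?_
    simp [he]; ring
  refine ⟨fun k => iteratedDerivWithin k e (Set.Ioi 0), by simp, ?_, ?_⟩
  · intro k x hx
    have hd := (hes (k + 1)).differentiableOn_iteratedDerivWithin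
      (by exact_mod_cast Nat.lt_succ_self k) hu x hx
    have := hd.hasDerivWithinAt.hasDerivAt (Ioi_mem_nhds hx)
    rwa [← iteratedDerivWithin_succ] at this
  · intro k
    induction k using Nat.strong_induction_on with
    | _ k ih =>
      intro x hx
      rcases k with _ | k
      · simp [he]; positivity
      · simp only
        rw [iteratedDerivWithin_succ', iteratedDerivWithin_congr hde hx,
          iteratedDerivWithin_neg,
          iteratedDerivWithin_mul (Set.mem_Ioi.2 hx) hu (hsmooth k x hx) (hes k x hx),
          pow_succ, mul_assoc, neg_one_mul, neg_neg, Finset.mul_sum]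
        refine Finset.sum_nonneg fun i hi => ?_
        have hik : i ≤ k := Nat.lt_succ_iff.mp (Finset.mem_range.mp hi)
        have a := hcm i x hx
        have b := ih (k - i) (by omega) x hx
        have : (-1 : ℝ) ^ k = (-1) ^ i * (-1) ^ (k - i) := by
          rw [← pow_add, Nat.add_sub_cancel' hik]
        rw [this]
        have c := mul_nonneg (mul_nonneg (Nat.cast_nonneg (α := ℝ) (k.choose i)) a) b
        calc _ ≤ _ := c
          _ = _ := by ring

/-- A finitely supported probability measure on the unit interval. -/
lemma exists_disc (c : ℕ → ℝ) (hc : ∀ k, 0 ≤ c k) (n : ℕ)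
    (hs : ∑ k ∈ Finset.range n, c k ≤ 1) (p : ℕ → Set.Icc (0:ℝ) 1) :
    ∃ ν : ProbabilityMeasure (Set.Icc (0:ℝ) 1), ∀ g : Set.Icc (0:ℝ) 1 → ℝ, Continuous g →
      ∫ t, g t ∂(ν : Measure (Set.Icc (0:ℝ) 1)) =
        ∑ k ∈ Finset.range n, c k * g (p k) + (1 - ∑ k ∈ Finset.range n, c k) * g 0 := by
  let m : Measure (Set.Icc (0:ℝ) 1) := ∑ k ∈ Finset.range n, ENNReal.ofReal (c k) • Measure.dirac (p k)
    + ENNReal.ofReal (1 - ∑ k ∈ Finset.range n, c k) • Measure.dirac 0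
  have hm : IsProbabilityMeasure m := by
    constructor
    simp only [m, Measure.add_apply, Measure.finsetSum_apply, Measure.smul_apply, measure_univ,
      smul_eq_mul, mul_one]
    rw [← ENNReal.ofReal_sum_of_nonneg (fun k _ => hc k),
      ← ENNReal.ofReal_add (Finset.sum_nonneg fun k _ => hc k) (by linarith)]
    simp
  refine ⟨⟨m, hm⟩, fun g hg => ?_⟩
  have hi : ∀ (a : ℝ) (q : Set.Icc (0:ℝ) 1),
      Integrable g (ENNReal.ofReal a • Measure.dirac q) := fun a q =>
    (integrable_dirac (by simp)).smul_measure (by simp)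
  simp only [ProbabilityMeasure.coe_mk, m]
  rw [integral_add_measure (integrable_finsetSum_measure.2 fun k _ => hi _ _) (hi _ _),
    integral_finsetSum_measure (fun k _ => hi _ _)]
  simp only [integral_smul_measure, integral_dirac, smul_eq_mul]
  rw [ENNReal.toReal_ofReal (by linarith)]
  congr 1
  exact Finset.sum_congr rfl fun k _ => by rw [ENNReal.toReal_ofReal (hc k)]

lemma exists_approx (f : ℕ → ℝ → ℝ)
    (hd : ∀ k x, 0 < x → HasDerivAt (f k) (f (k + 1) x) x)
    (hp : ∀ k x, 0 < x → 0 ≤ (-1 : ℝ) ^ k * f k x)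
    (h1 : ∀ x, 0 < x → f 0 x ≤ 1) (a : ℝ) (ha : 0 < a) (n : ℕ) :
    ∃ ν : ProbabilityMeasure (Set.Icc (0:ℝ) 1), ∀ x : ℝ, 0 < x →
      |f 0 (a - a * Real.exp (-(x / a))) - ∫ t, (t : ℝ) ^ x ∂(ν : Measure (Set.Icc (0:ℝ) 1))|
        ≤ (√(Real.exp (-(x / a)))) ^ n := by
  let G : ℕ → ℝ → ℝ := fun k s => (-a) ^ k * f k (a - a * s)
  have hpos : ∀ s : ℝ, s < 1 → 0 < a - a * s := fun s hs => by nlinarith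
  have hG : ∀ k s, s < 1 → HasDerivAt (G k) (G (k + 1) s) s := by
    intro k s hs
    have h2 : HasDerivAt (fun s : ℝ => a - a * s) (-a) s := by
      simpa using ((hasDerivAt_id s).const_mul a).const_sub a
    have h3 := ((hd k _ (hpos s hs)).comp s h2).const_mul ((-a) ^ k)
    refine h3.congr_deriv ?_
    simp only [G]
    ring
  have h0 : ∀ k s, s < 1 → 0 ≤ G k s := by
    intro k s hs
    have := mul_nonneg (pow_nonneg ha.le k) (hp k _ (hpos s hs))
    simp only [G]
    rw [neg_pow]
    linarith
  have hG1 : ∀ s, s < 1 → G 0 s ≤ 1 := by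
    intro s hs
    simpa [G] using h1 _ (hpos s hs)
  obtain ⟨ν, hν⟩ := exists_disc (fun k => G k 0 / (k.factorial : ℝ))
    (fun k => by have := h0 k 0 one_pos; positivity) n (tay_sum_le G hG h0 hG1 n)
    (fun k => ⟨Real.exp (-(k / a)), (Real.exp_pos _).le,
      Real.exp_le_one_iff.2 (by simp only [Left.neg_nonpos_iff]; positivity)⟩)
  refine ⟨ν, fun x hx => ?_⟩
  have hc : Continuous fun t : Set.Icc (0:ℝ) 1 => (t : ℝ) ^ x :=
    continuous_subtype_val.rpow_const fun _ => Or.inr hx.le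
  have hs1 : Real.exp (-(x / a)) < 1 := by
    rw [Real.exp_lt_one_iff]
    have : 0 < x / a := by positivity
    linarith
  have key : f 0 (a - a * Real.exp (-(x / a))) -
      ∫ t, (t : ℝ) ^ x ∂(ν : Measure (Set.Icc (0:ℝ) 1)) = tayRem G n (Real.exp (-(x / a))) := by
    rw [hν _ hc]
    unfold tayRem
    simp only [Set.Icc.coe_zero, Real.zero_rpow hx.ne', mul_zero, add_zero]
    congr 1
    · simp [G]
    · refine Finset.sum_congr rfl fun k _ => ?_
      rw [← Real.exp_mul, ← Real.exp_nat_mul]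
      congr 2
      ring
  rw [key]
  have hb := tay_bounds G hG h0 hG1 n _ (Real.exp_pos _).le hs1
  rw [abs_of_nonneg hb.1]
  exact hb.2

open Filter Topology in
lemma lim_aux (x : ℝ) :
    Tendsto (fun N : ℕ => ((N : ℝ) + 1) - ((N : ℝ) + 1) * Real.exp (-(x / ((N : ℝ) + 1))))
      atTop (𝓝 x) := by
  have hd : HasDerivAt (fun u : ℝ => -Real.exp (-(x * u))) x 0 := by
    have h1 : HasDerivAt (fun u : ℝ => -(x * u)) (-x) 0 := by
      simpa using ((hasDerivAt_id (0:ℝ)).const_mul x).fun_neg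
    simpa using h1.exp.fun_neg
  have h := hd.tendsto_slope_zero_right
  have hu : Tendsto (fun N : ℕ => 1 / ((N : ℝ) + 1)) atTop (𝓝[>] 0) := by
    refine tendsto_nhdsWithin_iff.2 ⟨tendsto_one_div_add_atTop_nhds_zero_nat, ?_⟩
    exact Eventually.of_forall fun N => by simp only [Set.mem_Ioi]; positivity
  refine (h.comp hu).congr fun N => ?_
  have : (N : ℝ) + 1 ≠ 0 := by positivity
  simp only [Function.comp, zero_add, mul_zero, neg_zero, Real.exp_zero, smul_eq_mul]
  rw [mul_one_div]
  field_simp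
  ring

open Filter Topology in
lemma exists_unit (f : ℕ → ℝ → ℝ)
    (hd : ∀ k x, 0 < x → HasDerivAt (f k) (f (k + 1) x) x)
    (hp : ∀ k x, 0 < x → 0 ≤ (-1 : ℝ) ^ k * f k x)
    (h1 : ∀ x, 0 < x → f 0 x ≤ 1) :
    ∃ ν : ProbabilityMeasure (Set.Icc (0:ℝ) 1), ∀ x : ℝ, 0 < x →
      ∫ t, (t : ℝ) ^ x ∂(ν : Measure (Set.Icc (0:ℝ) 1)) = f 0 x := by
  choose ν hν using fun N : ℕ =>
    exists_approx f hd hp h1 ((N : ℝ) + 1) (by positivity) ((N + 1) ^ 2)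
  let U : Ultrafilter ℕ := Ultrafilter.of atTop
  have hU : (U : Filter ℕ) ≤ atTop := Ultrafilter.of_le _
  obtain ⟨μ, -, hμ⟩ := isCompact_univ.ultrafilter_le_nhds (U.map ν) (by simp)
  have hμ' : Tendsto ν U (𝓝 μ) := hμ
  refine ⟨μ, fun x hx => ?_⟩
  have hc : Continuous fun t : Set.Icc (0:ℝ) 1 => (t : ℝ) ^ x :=
    continuous_subtype_val.rpow_const fun _ => Or.inr hx.le
  have hA := (ProbabilityMeasure.tendsto_iff_forall_integral_tendsto.1 hμ')
    (BoundedContinuousFunction.mkOfCompact ⟨_, hc⟩)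
  simp only [BoundedContinuousFunction.mkOfCompact_apply, ContinuousMap.coe_mk] at hA
  have hB : Tendsto (fun N : ℕ => f 0 (((N : ℝ) + 1) -
      ((N : ℝ) + 1) * Real.exp (-(x / ((N : ℝ) + 1))))) atTop (𝓝 (f 0 x)) :=
    (hd 0 x hx).continuousAt.tendsto.comp (lim_aux x)
  have hE : Tendsto (fun N : ℕ => (√(Real.exp (-(x / ((N : ℝ) + 1))))) ^ ((N + 1) ^ 2))
      atTop (𝓝 0) := by
    have hr : Real.exp (-(x / 2)) < 1 := by rw [Real.exp_lt_one_iff]; linarith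
    have := (tendsto_pow_atTop_nhds_zero_of_lt_one (Real.exp_pos _).le hr).comp
      (tendsto_add_atTop_nat 1)
    refine this.congr fun N => ?_
    simp only [Function.comp]
    have h0 : (N : ℝ) + 1 ≠ 0 := by positivity
    rw [← Real.exp_half, ← Real.exp_nat_mul, ← Real.exp_nat_mul]
    congr 1
    push_cast
    field_simp
  have hC : Tendsto (fun N : ℕ => ∫ t, (t : ℝ) ^ x ∂(ν N : Measure (Set.Icc (0:ℝ) 1)))
      atTop (𝓝 (f 0 x)) := by
    have hz := squeeze_zero_norm (fun N => by
      rw [Real.norm_eq_abs]; exact hν N x hx) hE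
    have := hB.sub hz
    simpa using this
  exact tendsto_nhds_unique hA (hC.mono_left hU)

open Filter Topology in
theorem stmt1 (φ φ' : ℝ → ℝ)
    (hφ0 : φ 0 = 0)
    (hcont : ContinuousOn φ (Set.Ici 0))
    (hnonneg : ∀ x : ℝ, 0 ≤ x → 0 ≤ φ x)
    (hderiv : ∀ x : ℝ, 0 < x → HasDerivAt φ (φ' x) x)
    (hsmooth : ∀ k : ℕ, ContDiffOn ℝ k φ' (Set.Ioi 0))
    (hcm : ∀ (k : ℕ) (x : ℝ), 0 < x →
      0 ≤ (-1 : ℝ) ^ k * iteratedDerivWithin k φ' (Set.Ioi 0) x) :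
    ∃ F : Measure ℝ, IsProbabilityMeasure F ∧ F (Set.Iio 0) = 0 ∧
      ∀ x : ℝ, 0 ≤ x → Real.exp (-(φ x)) = ∫ l, Real.exp (-(l * x)) ∂F := by
  obtain ⟨f, hf0, hd, hp⟩ := cm_exp φ φ' hderiv hsmooth hcm
  obtain ⟨ν, hν⟩ := exists_unit f hd hp (fun x hx => by
    rw [hf0]
    exact Real.exp_le_one_iff.2 (by linarith [hnonneg x hx.le]))
  simp only [hf0] at hν
  -- the limit measure has no atom at zero
  have hle : ∀ x : ℝ, 0 < x → Real.exp (-(φ x)) ≤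
      1 - (ν : Measure (Set.Icc (0:ℝ) 1)).real {0} := by
    intro x hx
    rw [← hν x hx, ← probReal_compl_eq_one_sub (measurableSet_singleton _),
      ← integral_indicator_one (measurableSet_singleton _).compl]
    have hc : Continuous fun t : Set.Icc (0:ℝ) 1 => (t : ℝ) ^ x :=
      continuous_subtype_val.rpow_const fun _ => Or.inr hx.le
    refine integral_mono
      (hc.integrable_of_hasCompactSupport (HasCompactSupport.of_compactSpace _))
      ((integrable_const (1:ℝ)).indicator (measurableSet_singleton _).compl) ?_
    intro t
    by_cases ht : t = 0
    · simp [ht, Real.zero_rpow hx.ne']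
    · simp only [Set.indicator, Set.mem_compl_iff, Set.mem_singleton_iff, ht, not_false_eq_true,
        if_true, Pi.one_apply]
      exact Real.rpow_le_one t.2.1 t.2.2 hx.le
  have hlim : Tendsto (fun x => Real.exp (-(φ x))) (𝓝[>] 0) (𝓝 1) := by
    have h := (hcont 0 Set.self_mem_Ici).mono_left
      (nhdsWithin_mono 0 Set.Ioi_subset_Ici_self)
    rw [hφ0] at h
    simpa [Function.comp_def] using (Real.continuous_exp.tendsto _).comp h.neg
  have hatom : (ν : Measure (Set.Icc (0:ℝ) 1)) {0} = 0 := by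
    have h := le_of_tendsto hlim (by
      filter_upwards [self_mem_nhdsWithin] with x hx using hle x hx)
    have h2 : (ν : Measure (Set.Icc (0:ℝ) 1)).real {0} = 0 :=
      le_antisymm (by linarith) measureReal_nonneg
    exact (measureReal_eq_zero_iff).1 h2
  have hmeas : Measurable fun t : Set.Icc (0:ℝ) 1 => -Real.log (t : ℝ) :=
    (Real.measurable_log.comp measurable_subtype_coe).neg
  have hprob : IsProbabilityMeasure ((ν : Measure (Set.Icc (0:ℝ) 1)).map
      fun t : Set.Icc (0:ℝ) 1 => -Real.log (t : ℝ)) :=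
    Measure.isProbabilityMeasure_map hmeas.aemeasurable
  refine ⟨(ν : Measure (Set.Icc (0:ℝ) 1)).map
    fun t : Set.Icc (0:ℝ) 1 => -Real.log (t : ℝ), hprob, ?_, ?_⟩
  · rw [Measure.map_apply hmeas measurableSet_Iio]
    convert measure_empty (μ := (ν : Measure (Set.Icc (0:ℝ) 1)))
    ext t
    simpa using Real.log_nonpos t.2.1 t.2.2
  · intro x hx
    rcases hx.eq_or_lt with rfl | hx
    · simp [hφ0]
    rw [integral_map hmeas.aemeasurable (by fun_prop), ← hν x hx]
    refine integral_congr_ae ?_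
    have hae : ∀ᵐ t ∂(ν : Measure (Set.Icc (0:ℝ) 1)), t ≠ 0 := by
      rw [ae_iff]
      simpa using hatom
    filter_upwards [hae] with t ht
    have htp : 0 < (t : ℝ) := lt_of_le_of_ne t.2.1 fun h => ht (Subtype.ext h.symm)
    rw [Real.rpow_def_of_pos htp]
    congr 1
    ring
end

section
/- (Geman–Yang duality, part A.) Let φ : ℝ → ℝ be a function such that θ(x) := x²/2 − φ(x) is closed (lower semi-continuous) and convex. Define ψ(λ) := sup_{x ∈ ℝ} { −(x − λ)²/2 + φ(x) }. Then for every x ∈ ℝ, φ(x) = inf_{λ ∈ ℝ} { (x − λ)²/2 + ψ(λ) }. -/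
lemma exists_subgrad (f : ℝ → ℝ) (hf : ConvexOn ℝ Set.univ f) (x : ℝ) :
    ∃ m : ℝ, ∀ y, f x + m * (y - x) ≤ f y := by
  have key : ∀ y z, y < x → x < z → (f x - f y) / (x - y) ≤ (f z - f x) / (z - x) :=
    fun y z hy hz => hf.slope_mono_adjacent (Set.mem_univ _) (Set.mem_univ _) hy hz
  let S : Set ℝ := (fun y => (f x - f y) / (x - y)) '' Set.Iio x
  have hub : ∀ z, x < z → (f z - f x) / (z - x) ∈ upperBounds S := by
    rintro z hz _ ⟨y, hy, rfl⟩
    exact key y z hy hz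
  have hne : S.Nonempty := ⟨_, x - 1, by simp, rfl⟩
  have hbdd : BddAbove S := ⟨_, hub (x + 1) (by linarith)⟩
  refine ⟨sSup S, fun y => ?_⟩
  rcases lt_trichotomy y x with h | h | h
  · have h1 : (f x - f y) / (x - y) ≤ sSup S := le_csSup hbdd ⟨y, h, rfl⟩
    rw [div_le_iff₀ (by linarith)] at h1
    linarith
  · subst h; simp
  · have h1 : sSup S ≤ (f y - f x) / (y - x) := csSup_le hne (hub y h)
    rw [le_div_iff₀ (by linarith)] at h1
    linarith

theorem stmt4 (φ : ℝ → ℝ)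
    (hlsc : LowerSemicontinuous (fun x : ℝ => x ^ 2 / 2 - φ x))
    (hconv : ConvexOn ℝ Set.univ (fun x : ℝ => x ^ 2 / 2 - φ x)) :
    ∀ x : ℝ, (φ x : EReal)
      = ⨅ l : ℝ, (((x - l) ^ 2 / 2 : ℝ) : EReal)
          + ⨆ y : ℝ, ((-(y - l) ^ 2 / 2 + φ y : ℝ) : EReal) := by
  intro x
  apply le_antisymm
  · refine le_iInf fun l => ?_
    calc (φ x : EReal) = (((x - l) ^ 2 / 2 : ℝ) : EReal)
          + ((-(x - l) ^ 2 / 2 + φ x : ℝ) : EReal) := by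
            rw [← EReal.coe_add]; congr 1; ring
      _ ≤ _ := add_le_add le_rfl
            (le_iSup (fun y : ℝ => ((-(y - l) ^ 2 / 2 + φ y : ℝ) : EReal)) x)
  · obtain ⟨l, hl⟩ := exists_subgrad _ hconv x
    refine (iInf_le _ l).trans ?_
    calc _ ≤ (((x - l) ^ 2 / 2 : ℝ) : EReal)
          + ((-(x - l) ^ 2 / 2 + φ x : ℝ) : EReal) := by
            refine add_le_add le_rfl (iSup_le fun y => ?_)
            have := hl y
            rw [EReal.coe_le_coe_iff]
            nlinarith
      _ = (φ x : EReal) := by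
            rw [← EReal.coe_add]; congr 1; ring
end

section
/- (Geman–Yang duality, part B.) Let φ : ℝ → ℝ be such that θ(x) := x²/2 − φ(x) is closed (lower semi-continuous) and convex, and define ψ(λ) := sup_{x ∈ ℝ} { −(x − λ)²/2 + φ(x) }. Then λ̂ attains the infimum in φ(x) = inf_{λ} { (x − λ)²/2 + ψ(λ) } if and only if λ̂ belongs to the subdifferential of θ at x, i.e. λ̂ ∈ ∂{ x²/2 − φ(x) }. In particular, if φ is differentiable at x, then λ̂(x) = x − φ′(x) attains the infimum. -/
theorem stmt5 (φ : ℝ → ℝ)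
    (hlsc : LowerSemicontinuous (fun x : ℝ => x ^ 2 / 2 - φ x))
    (hconv : ConvexOn ℝ Set.univ (fun x : ℝ => x ^ 2 / 2 - φ x)) :
    (∀ x lhat : ℝ,
      ((φ x : EReal) = (((x - lhat) ^ 2 / 2 : ℝ) : EReal)
          + ⨆ y : ℝ, ((-(y - lhat) ^ 2 / 2 + φ y : ℝ) : EReal))
        ↔ ∀ y : ℝ, y ^ 2 / 2 - φ y ≥ x ^ 2 / 2 - φ x + lhat * (y - x)) ∧
    (∀ x d : ℝ, HasDerivAt φ d x →
      (φ x : EReal) = (((x - (x - d)) ^ 2 / 2 : ℝ) : EReal)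
          + ⨆ y : ℝ, ((-(y - (x - d)) ^ 2 / 2 + φ y : ℝ) : EReal)) := by
  have key : ∀ x lhat : ℝ,
      ((φ x : EReal) = (((x - lhat) ^ 2 / 2 : ℝ) : EReal)
          + ⨆ y : ℝ, ((-(y - lhat) ^ 2 / 2 + φ y : ℝ) : EReal))
        ↔ ∀ y : ℝ, y ^ 2 / 2 - φ y ≥ x ^ 2 / 2 - φ x + lhat * (y - x) := by
    intro x l
    constructor
    · intro h y
      have h1 : (((x - l) ^ 2 / 2 : ℝ) : EReal) + ((-(y - l) ^ 2 / 2 + φ y : ℝ) : EReal)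
          ≤ (φ x : EReal) := by
        rw [h]
        exact add_le_add le_rfl
          (le_iSup (fun y : ℝ => ((-(y - l) ^ 2 / 2 + φ y : ℝ) : EReal)) y)
      rw [← EReal.coe_add, EReal.coe_le_coe_iff] at h1
      nlinarith
    · intro h
      have h1 : (⨆ y : ℝ, ((-(y - l) ^ 2 / 2 + φ y : ℝ) : EReal))
          = ((-(x - l) ^ 2 / 2 + φ x : ℝ) : EReal) := by
        apply le_antisymm
        · refine iSup_le fun y => ?_
          rw [EReal.coe_le_coe_iff]
          nlinarith [h y]
        · exact le_iSup (fun y : ℝ => ((-(y - l) ^ 2 / 2 + φ y : ℝ) : EReal)) x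
      rw [h1, ← EReal.coe_add]
      congr 1
      ring
  refine ⟨key, fun x d hd => (key x (x - d)).2 fun y => ?_⟩
  have hθ : HasDerivAt (fun x : ℝ => x ^ 2 / 2 - φ x) (x - d) x := by
    have h2 : HasDerivAt (fun x : ℝ => x ^ 2 / 2) x x := by
      have h3 := (hasDerivAt_pow 2 x).div_const 2
      have h4 : ((2 : ℕ) : ℝ) * x ^ (2 - 1) / 2 = x := by norm_num
      rwa [h4] at h3
    exact h2.sub hd
  rcases lt_trichotomy x y with hxy | rfl | hxy
  · have := hconv.le_slope_of_hasDerivAt (Set.mem_univ x) (Set.mem_univ y) hxy hθ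
    rw [slope_def_field, le_div_iff₀ (by linarith)] at this
    linarith
  · simp
  · have := hconv.slope_le_of_hasDerivAt (Set.mem_univ y) (Set.mem_univ x) hxy hθ
    rw [slope_def_field, div_le_iff₀ (by linarith)] at this
    linarith
end

section
/- (Dasgupta, 1994.) Let μ be a probability measure on (0,∞) and let p be the Gaussian scale mixture density p(x) = ∫₀^∞ N(x | 0, σ²) dμ(σ²). Then p can also be represented as a Gaussian location mixture with unit variance — i.e. there exists a probability measure ν on ℝ with p(x) = ∫_ℝ N(x | m, 1) dν(m) for all x — if and only if μ places no mass on the interval [0, 1), i.e. μ([0,1)) = 0. -/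
open MeasureTheory

open ProbabilityTheory in
lemma fourier_mix (κ : Measure ℝ) [IsProbabilityMeasure κ] (a b : ℝ → ℝ) (ha : Measurable a)
    (hb : Measurable b) (hpos : ∀ᵐ s ∂κ, 0 < b s) (t : ℝ) :
    ∫ x, ((∫ s, gaussianPDFReal (a s) (b s).toNNReal x ∂κ : ℝ) : ℂ) * Complex.exp (t * x * Complex.I)
      = ∫ s, Complex.exp (t * a s * Complex.I - b s * t ^ 2 / 2) ∂κ := by
  have hnorm : ∀ x : ℝ, ‖Complex.exp (t * x * Complex.I)‖ = 1 := fun x => by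
    have := Complex.norm_exp_ofReal_mul_I (t * x)
    simpa using this
  have hmeas : Measurable (fun z : ℝ × ℝ =>
      ((gaussianPDFReal (a z.2) (b z.2).toNNReal z.1 : ℝ) : ℂ) * Complex.exp (t * z.1 * Complex.I)) := by
    unfold gaussianPDFReal
    fun_prop
  have hint : Integrable (fun z : ℝ × ℝ =>
      ((gaussianPDFReal (a z.2) (b z.2).toNNReal z.1 : ℝ) : ℂ) * Complex.exp (t * z.1 * Complex.I))
      (volume.prod κ) := by
    rw [integrable_prod_iff' hmeas.aestronglyMeasurable]
    constructor
    · filter_upwards with s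
      refine Integrable.mono' (integrable_gaussianPDFReal (a s) (b s).toNNReal)
        (hmeas.comp (measurable_id.prodMk measurable_const)).aestronglyMeasurable ?_
      filter_upwards with x
      simp [hnorm, abs_of_nonneg (gaussianPDFReal_nonneg _ _ _)]
    · refine (integrable_const (1 : ℝ)).congr ?_
      filter_upwards [hpos] with s hs
      simp only [norm_mul, hnorm, mul_one, Complex.norm_real, Real.norm_eq_abs,
        abs_of_nonneg (gaussianPDFReal_nonneg _ _ _)]
      rw [integral_gaussianPDFReal_eq_one _ (by simpa using hs)]
  calc _ = ∫ x, ∫ s, ((gaussianPDFReal (a s) (b s).toNNReal x : ℝ) : ℂ)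
            * Complex.exp (t * x * Complex.I) ∂κ := by
        congr 1; ext x
        rw [integral_mul_const, integral_complex_ofReal]
    _ = _ := integral_integral_swap hint
    _ = _ := by
        apply integral_congr_ae
        filter_upwards [hpos] with s hs
        have h1 := charFun_gaussianReal (μ := a s) (v := (b s).toNNReal) t
        rw [charFun_apply_real, integral_gaussianReal_eq_integral_smul (by simpa using hs)] at h1
        simp only [Complex.real_smul, Real.coe_toNNReal _ hs.le] at h1
        exact h1

lemma gauss_conv (s x : ℝ) (hs : 1 ≤ s) :
    ∫ z, (2 * Real.pi) ^ (-(1 / 2 : ℝ)) * Real.exp (-((x - Real.sqrt (s - 1) * z) ^ 2 / 2))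
      ∂(ProbabilityTheory.gaussianReal 0 1)
      = (2 * Real.pi * s) ^ (-(1 / 2 : ℝ)) * Real.exp (-(x ^ 2 / (2 * s))) := by
  rw [ProbabilityTheory.integral_gaussianReal_eq_integral_smul (by simp)]
  have h0 : 0 < s := by linarith
  have hpi := Real.pi_pos
  set a := Real.sqrt (s - 1) with hadef
  have ha : a ^ 2 = s - 1 := Real.sq_sqrt (by linarith)
  have e : ∀ z : ℝ, ProbabilityTheory.gaussianPDFReal 0 1 z •
      ((2 * Real.pi) ^ (-(1 / 2 : ℝ)) * Real.exp (-((x - a * z) ^ 2 / 2)))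
      = ((2 * Real.pi)⁻¹ * Real.exp (-(x ^ 2 / (2 * s)))) *
        Real.exp (-(s / 2) * (z - a * x / s) ^ 2) := by
    intro z
    have h1 : Real.exp (-(z ^ 2 / 2)) * Real.exp (-((x - a * z) ^ 2 / 2))
      = Real.exp (-(x ^ 2 / (2 * s))) * Real.exp (-(s / 2) * (z - a * x / s) ^ 2) := by
      rw [← Real.exp_add, ← Real.exp_add]
      congr 1
      field_simp
      have hs2 : s = a ^ 2 + 1 := by linarith
      rw [hs2]; ring
    have h2 : (√(2 * Real.pi))⁻¹ * (2 * Real.pi) ^ (-(1 / 2 : ℝ)) = (2 * Real.pi)⁻¹ := by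
      rw [Real.sqrt_eq_rpow, ← Real.rpow_neg (by positivity), ← Real.rpow_add (by positivity),
        ← Real.rpow_neg_one]
      norm_num
    rw [mul_assoc, ← h1, ← h2]
    simp only [ProbabilityTheory.gaussianPDFReal, smul_eq_mul, NNReal.coe_one, mul_one, sub_zero,
      neg_div]
    ring
  simp_rw [e]
  rw [integral_const_mul, integral_sub_right_eq_self (fun z => Real.exp (-(s / 2) * z ^ 2)),
    integral_gaussian]
  have h3 : (2 * Real.pi)⁻¹ * √(Real.pi / (s / 2)) = (2 * Real.pi * s) ^ (-(1 / 2 : ℝ)) := by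
    rw [Real.rpow_neg (by positivity), ← Real.sqrt_eq_rpow,
      show Real.pi / (s / 2) = (2 * Real.pi) ^ 2 / (2 * Real.pi * s) by field_simp,
      Real.sqrt_div (by positivity), Real.sqrt_sq (by positivity)]
    field_simp
  rw [← h3]; ring

theorem stmt7 (μ : Measure ℝ) (hμ : IsProbabilityMeasure μ)
    (hμpos : μ (Set.Iic 0) = 0)
    (p : ℝ → ℝ)
    (hp : ∀ x : ℝ,
      p x = ∫ s, (2 * Real.pi * s) ^ (-(1 / 2 : ℝ)) * Real.exp (-(x ^ 2 / (2 * s))) ∂μ) :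
    (∃ ν : Measure ℝ, IsProbabilityMeasure ν ∧
        ∀ x : ℝ,
          p x = ∫ m, (2 * Real.pi) ^ (-(1 / 2 : ℝ)) * Real.exp (-((x - m) ^ 2 / 2)) ∂ν)
      ↔ μ (Set.Ico 0 1) = 0 := by
  have hpi := Real.pi_pos
  have hpos : ∀ᵐ s ∂μ, 0 < s := by
    rw [ae_iff]
    convert hμpos using 2
    ext s; simp
  constructor
  · rintro ⟨ν, hν, h⟩
    have p1 : ∀ x, p x = ∫ s, ProbabilityTheory.gaussianPDFReal 0 s.toNNReal x ∂μ := by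
      intro x
      rw [hp]
      apply integral_congr_ae
      filter_upwards [hpos] with s hs
      simp only [ProbabilityTheory.gaussianPDFReal, Real.coe_toNNReal _ hs.le, sub_zero, neg_div]
      rw [Real.rpow_neg (by positivity), Real.sqrt_eq_rpow]
    have p2 : ∀ x, p x = ∫ m, ProbabilityTheory.gaussianPDFReal m (1 : ℝ).toNNReal x ∂ν := by
      intro x
      rw [h]
      congr 1; ext m
      simp only [ProbabilityTheory.gaussianPDFReal, Real.toNNReal_one, NNReal.coe_one, mul_one,
        neg_div]
      rw [Real.rpow_neg (by positivity), Real.sqrt_eq_rpow]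
    have key : ∀ t : ℝ, ∫ s, Real.exp (-(t ^ 2 / 2) * s) ∂μ ≤ Real.exp (-(t ^ 2 / 2)) := by
      intro t
      have f1 := fourier_mix μ (fun _ => 0) (fun s => s) measurable_const measurable_id hpos t
      have f2 := fourier_mix ν (fun m => m) (fun _ => 1) measurable_id measurable_const
        (by simp) t
      simp_rw [← p1] at f1
      simp_rw [← p2] at f2
      rw [f1] at f2
      have e1 : ∫ s : ℝ, Complex.exp (t * ((0 : ℝ) : ℂ) * Complex.I - s * t ^ 2 / 2) ∂μ
          = ((∫ s, Real.exp (-(t ^ 2 / 2) * s) ∂μ : ℝ) : ℂ) := by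
        rw [← integral_complex_ofReal]
        congr 1; ext s
        push_cast
        congr 1; ring
      rw [e1] at f2
      have f3 := congrArg norm f2
      rw [Complex.norm_real, Real.norm_of_nonneg (integral_nonneg fun s => (Real.exp_pos _).le)]
        at f3
      rw [f3]
      refine (norm_integral_le_of_norm_le_const (C := Real.exp (-(t ^ 2 / 2))) ?_).trans (by simp)
      filter_upwards with m
      rw [Complex.norm_exp]
      apply le_of_eq
      congr 1
      have : ((t : ℂ) * m * Complex.I - ((1 : ℝ) : ℂ) * t ^ 2 / 2)
        = ((-(t ^ 2 / 2) : ℝ) : ℂ) + ((t * m : ℝ) : ℂ) * Complex.I := by push_cast; ring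
      rw [this, Complex.add_re, Complex.re_ofReal_mul]
      simp only [Complex.ofReal_re, Complex.I_re, mul_zero, add_zero]
    have hz : ∀ c : ℝ, c < 1 → μ (Set.Iic c) = 0 := by
      intro c hc
      have hb : ∀ n : ℕ, μ.real (Set.Iic c) ≤ (Real.exp (-(1 - c))) ^ n := by
        intro n
        have ht : (Real.sqrt (2 * n)) ^ 2 / 2 = n := by
          rw [Real.sq_sqrt (by positivity)]; ring
        have k := key (Real.sqrt (2 * n))
        rw [ht] at k
        have ch := ProbabilityTheory.measure_le_le_exp_mul_mgf (μ := μ) (X := fun s => s)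
          (t := -(n : ℝ)) c (by simp) (by
            refine Integrable.mono' (integrable_const (1 : ℝ)) (by fun_prop) ?_
            filter_upwards [hpos] with s hs
            rw [Real.norm_of_nonneg (Real.exp_pos _).le, Real.exp_le_one_iff]
            have : 0 ≤ (n : ℝ) * s := by positivity
            linarith)
        refine ch.trans ((mul_le_mul_of_nonneg_left k (Real.exp_pos _).le).trans (le_of_eq ?_))
        rw [← Real.exp_add, ← Real.exp_nat_mul]
        congr 1; ring
      have hl := tendsto_pow_atTop_nhds_zero_of_lt_one (Real.exp_pos (-(1 - c))).le
        (Real.exp_lt_one_iff.2 (by linarith))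
      have := ge_of_tendsto' hl hb
      have h0 : μ.real (Set.Iic c) = 0 := le_antisymm this measureReal_nonneg
      exact (measureReal_eq_zero_iff).1 h0
    refine measure_mono_null (t := ⋃ n : ℕ, Set.Iic (1 - 1 / ((n : ℝ) + 1))) ?_
      (measure_iUnion_null fun n => hz _ (by
        have : (0 : ℝ) < 1 / ((n : ℝ) + 1) := by positivity
        linarith))
    rintro s ⟨-, hs⟩
    obtain ⟨n, hn⟩ := exists_nat_one_div_lt (sub_pos.2 hs)
    exact Set.mem_iUnion.2 ⟨n, by simp only [Set.mem_Iic]; linarith⟩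
  · intro h0
    have hge : ∀ᵐ s ∂μ, 1 ≤ s := by
      filter_upwards [hpos, measure_eq_zero_iff_ae_notMem.1 h0] with s h1 h2
      by_contra h3
      exact h2 ⟨h1.le, not_le.1 h3⟩
    have hm : Measurable (fun z : ℝ × ℝ => Real.sqrt (z.1 - 1) * z.2) := by fun_prop
    refine ⟨(μ.prod (ProbabilityTheory.gaussianReal 0 1)).map
      (fun z : ℝ × ℝ => Real.sqrt (z.1 - 1) * z.2),
      Measure.isProbabilityMeasure_map hm.aemeasurable, fun x => ?_⟩
    rw [integral_map hm.aemeasurable (by fun_prop), integral_prod, hp]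
    · apply integral_congr_ae
      filter_upwards [hge] with s hs
      exact (gauss_conv s x hs).symm
    · refine Integrable.mono' (integrable_const ((2 * Real.pi) ^ (-(1 / 2 : ℝ)))) (by fun_prop) ?_
      filter_upwards with z
      rw [Real.norm_of_nonneg (by positivity)]
      refine mul_le_of_le_one_right (by positivity) ?_
      rw [Real.exp_le_one_iff]
      have := sq_nonneg (x - Real.sqrt (z.1 - 1) * z.2)
      linarith
end

section
/- Let p be a probability density on (0,∞) and suppose f(x) = ∫₀^∞ N(x | 0, λ^{−1}) p(λ) dλ is finite for all x ∈ ℝ, with ∫₀^∞ λ N(x | 0, λ^{−1}) p(λ) dλ also finite for all x. Then f is differentiable with f′(x) = −x ∫₀^∞ λ N(x | 0, λ^{−1}) p(λ) dλ, and consequently, writing φ = −log f, for every x ≠ 0, φ′(x)/x = [ ∫₀^∞ λ N(x | 0, λ^{−1}) p(λ) dλ ] / f(x) = E(λ | x), the posterior mean of the precision λ given x in the Gaussian scale mixture model. -/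
open MeasureTheory

theorem stmt13 (p f : ℝ → ℝ)
    (hp0 : ∀ l : ℝ, 0 < l → 0 ≤ p l)
    (hp1 : ∫ l in Set.Ioi (0:ℝ), p l = 1)
    (hint1 : ∀ x : ℝ, IntegrableOn
      (fun l => Real.sqrt (l / (2 * Real.pi)) * Real.exp (-(l * x ^ 2 / 2)) * p l)
      (Set.Ioi 0))
    (hint2 : ∀ x : ℝ, IntegrableOn
      (fun l => l * (Real.sqrt (l / (2 * Real.pi)) * Real.exp (-(l * x ^ 2 / 2))) * p l)
      (Set.Ioi 0))
    (hf : ∀ x : ℝ, f x = ∫ l in Set.Ioi (0:ℝ),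
      Real.sqrt (l / (2 * Real.pi)) * Real.exp (-(l * x ^ 2 / 2)) * p l) :
    ∀ x : ℝ,
      HasDerivAt f
        (-(x * ∫ l in Set.Ioi (0:ℝ),
            l * (Real.sqrt (l / (2 * Real.pi)) * Real.exp (-(l * x ^ 2 / 2))) * p l)) x ∧
      (x ≠ 0 →
        deriv (fun y => -Real.log (f y)) x / x
          = (∫ l in Set.Ioi (0:ℝ),
              l * (Real.sqrt (l / (2 * Real.pi)) * Real.exp (-(l * x ^ 2 / 2))) * p l)
            / f x) := by
  have hpos : ∀ x : ℝ, f x ≠ 0 := by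
    intro x h0
    rw [hf x] at h0
    have hnn : 0 ≤ᵐ[volume.restrict (Set.Ioi (0:ℝ))]
        (fun l => Real.sqrt (l / (2 * Real.pi)) * Real.exp (-(l * x ^ 2 / 2)) * p l) := by
      filter_upwards [ae_restrict_mem measurableSet_Ioi] with l hl
      have := hp0 l hl
      simp only [Pi.zero_apply]
      positivity
    have h1 := (integral_eq_zero_iff_of_nonneg_ae hnn (hint1 x)).1 h0
    have h2 : p =ᵐ[volume.restrict (Set.Ioi (0:ℝ))] 0 := by
      filter_upwards [h1, ae_restrict_mem measurableSet_Ioi] with l hl hl0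
      have hl0' : (0:ℝ) < l := hl0
      have h3 : Real.sqrt (l / (2 * Real.pi)) * Real.exp (-(l * x ^ 2 / 2)) ≠ 0 := by positivity
      exact (mul_eq_zero.1 hl).resolve_left h3
    rw [integral_congr_ae h2] at hp1
    simp at hp1
  intro x
  have key : HasDerivAt f
        (-(x * ∫ l in Set.Ioi (0:ℝ),
            l * (Real.sqrt (l / (2 * Real.pi)) * Real.exp (-(l * x ^ 2 / 2))) * p l)) x := by
    have h := hasDerivAt_integral_of_dominated_loc_of_deriv_le
      (μ := volume.restrict (Set.Ioi (0:ℝ))) (x₀ := x)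
      (F := fun y l => Real.sqrt (l / (2 * Real.pi)) * Real.exp (-(l * y ^ 2 / 2)) * p l)
      (F' := fun y l => -y *
        (l * (Real.sqrt (l / (2 * Real.pi)) * Real.exp (-(l * y ^ 2 / 2))) * p l))
      (bound := fun l => (|x| + 1) *
        (l * (Real.sqrt (l / (2 * Real.pi)) * Real.exp (-(l * (0:ℝ) ^ 2 / 2))) * p l))
      (Metric.ball_mem_nhds x one_pos)
      (Filter.Eventually.of_forall fun y => (hint1 y).aestronglyMeasurable)
      (hint1 x) ((hint2 x).const_mul (-x)).aestronglyMeasurable ?_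
      ((hint2 0).const_mul _) ?_
    · have h2 := h.2
      rw [integral_const_mul, neg_mul] at h2
      exact h2.congr_of_eventuallyEq (Filter.Eventually.of_forall hf)
    · filter_upwards [ae_restrict_mem measurableSet_Ioi] with l hl y hy
      have hl0 : (0:ℝ) < l := hl
      have hp := hp0 l hl
      rw [norm_mul, norm_neg, Real.norm_eq_abs, Real.norm_eq_abs, abs_of_nonneg
        (show 0 ≤ l * (Real.sqrt (l / (2 * Real.pi)) * Real.exp (-(l * y ^ 2 / 2))) * p l by
          positivity)]
      have hy' : |y| ≤ |x| + 1 := by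
        rw [Metric.mem_ball, Real.dist_eq] at hy
        have := abs_sub_abs_le_abs_sub y x
        linarith
      have : l * (0:ℝ) ^ 2 / 2 ≤ l * y ^ 2 / 2 := by
        have : 0 ≤ l * y ^ 2 / 2 := by positivity
        simpa using this
      gcongr
    · refine Filter.Eventually.of_forall fun l y _ => ?_
      have h1 : HasDerivAt (fun y : ℝ => -(l * y ^ 2 / 2)) (-(l * y)) y := by
        have := ((((hasDerivAt_id y).pow 2).const_mul l).div_const 2).neg
        refine this.congr_deriv ?_
        simp
        ring
      refine ((h1.exp.const_mul (Real.sqrt (l / (2 * Real.pi)))).mul_const (p l)).congr_deriv ?_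
      ring
  refine ⟨key, fun hx => ?_⟩
  have hd : deriv (fun y => -Real.log (f y)) x = _ := ((key.log (hpos x)).neg).deriv
  rw [hd]
  have := hpos x
  field_simp
end

section
/- (Concave conjugate of the minimax concave penalty.) Fix γ > 0 and a > 0, and define the MCP function φ(x) = γx − x²/(2a) for 0 ≤ x < aγ and φ(x) = aγ²/2 for x ≥ aγ. Then for every λ ≥ 0, inf_{x ≥ 0} { λx − φ(x) } = −(a/2) (max(γ − λ, 0))². Consequently φ admits the envelope representation φ(x) = inf_{λ ≥ 0} { λx + (a/2)(max(γ − λ, 0))² } for all x ≥ 0. -/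
/-- The minimax concave penalty (MCP) with parameters `γ` and `a`. -/
noncomputable def mcp (γ a x : ℝ) : ℝ :=
  if x < a * γ then γ * x - x ^ 2 / (2 * a) else a * γ ^ 2 / 2

theorem mcp_young (γ a : ℝ) (hγ : 0 < γ) (ha : 0 < a) (x l : ℝ) (hx : 0 ≤ x) (hl : 0 ≤ l) :
    mcp γ a x ≤ l * x + (a / 2) * (max (γ - l) 0) ^ 2 := by
  unfold mcp
  have hsq : 0 ≤ x ^ 2 / (2 * a) := by positivity
  rcases le_total l γ with h | h
  · rw [max_eq_left (by linarith)]
    split_ifs with hc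
    · have h1 : l * x + (a / 2) * (γ - l) ^ 2 - (γ * x - x ^ 2 / (2 * a))
          = (a * (γ - l) - x) ^ 2 / (2 * a) := by
        field_simp
        ring
      have h2 : 0 ≤ (a * (γ - l) - x) ^ 2 / (2 * a) := by positivity
      linarith
    · have h1 : l * (a * γ) ≤ l * x := mul_le_mul_of_nonneg_left (not_lt.mp hc) hl
      have h2 : 0 ≤ a * l ^ 2 := by positivity
      nlinarith
  · rw [max_eq_right (by linarith)]
    have h0 : γ * x ≤ l * x := mul_le_mul_of_nonneg_right h hx
    split_ifs with hc
    · linarith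
    · have h1 : γ * (a * γ) ≤ γ * x := mul_le_mul_of_nonneg_left (not_lt.mp hc) hγ.le
      have h2 : 0 ≤ a * γ ^ 2 := by positivity
      nlinarith

theorem stmt16 (γ a : ℝ) (hγ : 0 < γ) (ha : 0 < a) :
    (∀ l : ℝ, 0 ≤ l →
      sInf {v : ℝ | ∃ x : ℝ, 0 ≤ x ∧ v = l * x - mcp γ a x}
        = -(a / 2) * (max (γ - l) 0) ^ 2) ∧
    (∀ x : ℝ, 0 ≤ x →
      mcp γ a x
        = sInf {v : ℝ | ∃ l : ℝ, 0 ≤ l ∧ v = l * x + (a / 2) * (max (γ - l) 0) ^ 2}) := by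
  constructor
  · intro l hl
    apply IsLeast.csInf_eq
    constructor
    · refine ⟨a * max (γ - l) 0, by positivity, ?_⟩
      unfold mcp
      rcases le_total l γ with h | h
      · rw [max_eq_left (by linarith)]
        split_ifs with hc
        · field_simp
          ring
        · have h0 : l = 0 := by
            have h1 : a * γ ≤ a * (γ - l) := not_lt.mp hc
            have h2 := le_of_mul_le_mul_left h1 ha
            linarith
          subst h0
          ring
      · rw [max_eq_right (by linarith), if_pos (by rw [mul_zero]; positivity)]
        simp
    · rintro v ⟨x, hx, rfl⟩
      have := mcp_young γ a hγ ha x l hx hl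
      linarith
  · intro x hx
    symm
    apply IsLeast.csInf_eq
    constructor
    · refine ⟨max (γ - x / a) 0, le_max_right _ _, ?_⟩
      unfold mcp
      have hxa : 0 ≤ x / a := by positivity
      split_ifs with hc
      · have h1 : x / a < γ := by rw [div_lt_iff₀ ha]; linarith
        rw [max_eq_left (a := γ - x / a) (by linarith),
          max_eq_left (a := γ - (γ - x / a)) (by linarith)]
        field_simp
        ring
      · have h1 : γ ≤ x / a := by rw [le_div_iff₀ ha]; linarith
        rw [max_eq_right (a := γ - x / a) (by linarith), sub_zero, max_eq_left hγ.le]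
        ring
    · rintro v ⟨l, hl, rfl⟩
      exact mcp_young γ a hγ ha x l hx hl
end

section
/- (Dual of the limited-translation loss.) Let φ(x) = min(1, x²/2). Then for every λ ≥ 0, ψ(λ) := sup_{x ∈ ℝ} { −(1/2)(x − λ)² + min(1, x²/2) } equals 1 − (√2 − λ)²/2 if 0 ≤ λ ≤ √2, and equals 1 if λ > √2. Consequently, φ(x) = inf_{λ ∈ ℝ} { (1/2)(x − λ)² + ψ(|λ|) } for every x ∈ ℝ. -/
/-- The Geman–Yang dual `ψ(λ) = sup_x { −(x − λ)²/2 + min(1, x²/2) }`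
of the limited-translation loss. -/
noncomputable def ltPsi (l : ℝ) : ℝ :=
  sSup {v : ℝ | ∃ x : ℝ, v = -(1 / 2) * (x - l) ^ 2 + min 1 (x ^ 2 / 2)}

theorem ltPsi_eq (l : ℝ) (hl : 0 ≤ l) :
    ltPsi l = if l ≤ Real.sqrt 2 then 1 - (Real.sqrt 2 - l) ^ 2 / 2 else 1 := by
  have hs : Real.sqrt 2 ^ 2 = 2 := Real.sq_sqrt (by norm_num)
  have hs0 : 0 ≤ Real.sqrt 2 := Real.sqrt_nonneg 2
  set s := Real.sqrt 2
  apply IsGreatest.csSup_eq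
  split_ifs with h
  · constructor
    · refine ⟨s, ?_⟩
      rw [hs]; norm_num; ring
    · rintro v ⟨x, rfl⟩
      rcases le_total x s with hx | hx
      · have := min_le_right 1 (x ^ 2 / 2)
        nlinarith [mul_le_mul_of_nonneg_right hx hl]
      · have := min_le_left 1 (x ^ 2 / 2)
        nlinarith
  · push Not at h
    constructor
    · refine ⟨l, ?_⟩
      rw [min_eq_left (by nlinarith)]; ring
    · rintro v ⟨x, rfl⟩
      have := min_le_left 1 (x ^ 2 / 2)
      nlinarith [sq_nonneg (x - l)]

theorem le_ltPsi (l x : ℝ) :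
    -(1 / 2) * (x - l) ^ 2 + min 1 (x ^ 2 / 2) ≤ ltPsi l := by
  refine le_csSup ?_ (Set.mem_setOf_eq ▸ ⟨x, rfl⟩)
  refine ⟨1, ?_⟩
  rintro v ⟨y, rfl⟩
  have := min_le_left 1 (y ^ 2 / 2)
  nlinarith [sq_nonneg (y - l)]

theorem stmt19 :
    (∀ l : ℝ, 0 ≤ l →
      ltPsi l = if l ≤ Real.sqrt 2 then 1 - (Real.sqrt 2 - l) ^ 2 / 2 else 1) ∧
    (∀ x : ℝ, min 1 (x ^ 2 / 2)
        = sInf {v : ℝ | ∃ l : ℝ, v = (1 / 2) * (x - l) ^ 2 + ltPsi |l|}) := by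
  refine ⟨ltPsi_eq, fun x => ?_⟩
  have hs : Real.sqrt 2 ^ 2 = 2 := Real.sq_sqrt (by norm_num)
  have hs0 : 0 ≤ Real.sqrt 2 := Real.sqrt_nonneg 2
  symm
  apply IsLeast.csInf_eq
  constructor
  · rcases le_or_gt |x| (Real.sqrt 2) with hx | hx
    · refine ⟨0, ?_⟩
      have h2 : x ^ 2 ≤ 2 := by
        rw [← sq_abs, ← hs]; gcongr
      rw [abs_zero, ltPsi_eq 0 le_rfl, if_pos hs0, min_eq_right (by linarith), sub_zero, sub_zero, hs]
      ring
    · refine ⟨x, ?_⟩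
      have h2 : 2 ≤ x ^ 2 := by
        rw [← sq_abs x, ← hs]; gcongr
      rw [ltPsi_eq _ (abs_nonneg x), if_neg (not_le.mpr hx), min_eq_left (by linarith)]
      ring
  · rintro v ⟨l, rfl⟩
    have h := le_ltPsi |l| |x|
    rw [sq_abs] at h
    have h3 : (|x| - |l|) ^ 2 ≤ (x - l) ^ 2 :=
      sq_le_sq.mpr (abs_abs_sub_abs_le_abs_sub x l)
    linarith
end
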